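/- arXiv:1810.08657 — 2 statements merged into one kernel-verified Lean document; each statement's English description precedes it below -/
import Mathlib

section
/- Let n and r be integers with n ≥ 2 and 1 ≤ r ≤ n − 1. Then every finite simple graph G of order n with CR(G) = 0 and γ_CR(G) = r satisfies |E(G)| ≤ C(n−r+1, 2), and there exists a finite simple graph G of order n with CR(G) = 0, γ_CR(G) = r, and |E(G)| = C(n−r+1, 2). In other words, M(n,0,r) = C(n−r+1, 2). -/
open SimpleGraph Set

/-- The closed neighborhood `N[v]` of a vertex `v`. -/
def closedNbhd {V : Type*} (G : SimpleGraph V) (v : V) : Set V :=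
  insert v (G.neighborSet v)

/-- `S` is a dominating set of `G`: every vertex lies in `N[s]` for some `s ∈ S`. -/
def IsDomSet {V : Type*} (G : SimpleGraph V) (S : Set V) : Prop :=
  ∀ v : V, ∃ s ∈ S, v ∈ closedNbhd G s

/-- `CR(S)`: the number of vertices overdominated by `S`, i.e. with `|N[x] ∩ S| ≥ 2`. -/
noncomputable def crOf {V : Type*} (G : SimpleGraph V) (S : Set V) : ℕ :=
  {x : V | 2 ≤ (closedNbhd G x ∩ S).ncard}.ncard

/-- `CR(G)`: the minimum of `CR(S)` over all dominating sets `S` of `G`. -/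
noncomputable def crNum {V : Type*} (G : SimpleGraph V) : ℕ :=
  sInf {k : ℕ | ∃ S : Set V, IsDomSet G S ∧ crOf G S = k}

/-- `γ_CR(G)`: the minimum cardinality of a dominating set `S` with `CR(S) = CR(G)`. -/
noncomputable def gammaCR {V : Type*} (G : SimpleGraph V) : ℕ :=
  sInf {r : ℕ | ∃ S : Set V, IsDomSet G S ∧ crOf G S = crNum G ∧ S.ncard = r}

theorem mem_closedNbhd {V : Type*} {G : SimpleGraph V} {u v : V} :
    u ∈ closedNbhd G v ↔ u = v ∨ G.Adj v u := Iff.rfl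

theorem crOf_eq_zero_iff {V : Type*} [Finite V] {G : SimpleGraph V} {S : Set V} :
    crOf G S = 0 ↔
      ∀ x, ∀ a ∈ S, ∀ b ∈ S, a ∈ closedNbhd G x → b ∈ closedNbhd G x → a = b := by
  rw [crOf, Set.ncard_eq_zero, Set.eq_empty_iff_forall_notMem]
  refine forall_congr' fun x => ?_
  rw [Set.mem_ofPred_eq, not_le, Nat.lt_succ_iff, Set.ncard_le_one_iff]
  constructor
  · intro h a ha b hb hxa hxb
    exact h ⟨hxa, ha⟩ ⟨hxb, hb⟩
  · intro h a b ha hb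
    exact h a ha.2 b hb.2 ha.1 hb.1

theorem exists_crOf_eq_crNum {V : Type*} (G : SimpleGraph V) :
    ∃ S : Set V, IsDomSet G S ∧ crOf G S = crNum G :=
  Nat.sInf_mem (s := {k : ℕ | ∃ S : Set V, IsDomSet G S ∧ crOf G S = k})
    ⟨_, Set.univ, fun v => ⟨v, Set.mem_univ v, Or.inl rfl⟩, rfl⟩

theorem exists_ncard_eq_gammaCR {V : Type*} (G : SimpleGraph V) :
    ∃ S : Set V, IsDomSet G S ∧ crOf G S = crNum G ∧ S.ncard = gammaCR G := by
  obtain ⟨S, hS, hk⟩ := exists_crOf_eq_crNum G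
  exact Nat.sInf_mem
    (s := {r : ℕ | ∃ S : Set V, IsDomSet G S ∧ crOf G S = crNum G ∧ S.ncard = r})
    ⟨_, S, hS, hk, rfl⟩

/-- Contracting an efficient dominating set to a point is injective on edges. -/
theorem ncard_edgeSet_le_of_crOf_eq_zero {V : Type*} [Fintype V] {G : SimpleGraph V}
    {S : Set V} (hS : crOf G S = 0) :
    G.edgeSet.ncard ≤ (Fintype.card V - S.ncard + 1).choose 2 := by
  classical
  rw [crOf_eq_zero_iff] at hS
  have hind : ∀ a ∈ S, ∀ b ∈ S, ¬ G.Adj a b := fun a ha b hb hab =>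
    hab.ne (hS a a ha b hb (Or.inl rfl) (Or.inr hab))
  have huniq : ∀ x, ∀ a ∈ S, ∀ b ∈ S, G.Adj x a → G.Adj x b → a = b :=
    fun x a ha b hb hxa hxb => hS x a ha b hb (Or.inr hxa) (Or.inr hxb)
  let f : V → Option (Sᶜ : Set V) := fun v => if h : v ∈ S then none else some ⟨v, h⟩
  have hf : ∀ u v, f u = f v → u = v ∨ u ∈ S ∧ v ∈ S := by
    intro u v h
    by_cases hu : u ∈ S <;> by_cases hv : v ∈ S <;> simp_all [f]
  have hcard : Fintype.card (Option (Sᶜ : Set V)) = Fintype.card V - S.ncard + 1 := by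
    rw [Fintype.card_option, ← Nat.card_eq_fintype_card (α := (Sᶜ : Set V)),
      Nat.card_coe_set_eq, Set.ncard_compl, Nat.card_eq_fintype_card]
  rw [← hcard, ← SimpleGraph.card_edgeFinset_top_eq_card_choose_two,
    ← Set.ncard_coe_finset, SimpleGraph.coe_edgeFinset]
  refine Set.ncard_le_ncard_of_injOn (Sym2.map f) ?_ ?_ (Set.toFinite _)
  · intro e
    induction e with | _ a b
    intro hab
    rw [SimpleGraph.mem_edgeSet] at hab
    rw [Sym2.map_mk, SimpleGraph.mem_edgeSet, SimpleGraph.top_adj]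
    intro h
    rcases hf a b h with h | ⟨ha, hb⟩
    · exact hab.ne h
    · exact hind a ha b hb hab
  · intro e
    induction e with | _ a b
    intro hab e'
    induction e' with | _ c d
    intro hcd h
    rw [SimpleGraph.mem_edgeSet] at hab hcd
    rw [Sym2.map_mk, Sym2.map_mk, Sym2.eq_iff] at h
    rw [Sym2.eq_iff]
    have key : ∀ a b c d, G.Adj a b → G.Adj c d → f a = f c → f b = f d →
        a = c ∧ b = d := by
      intro a b c d hab hcd hac hbd
      rcases hf a c hac with rfl | ⟨ha, hc⟩ <;> rcases hf b d hbd with rfl | ⟨hb, hd⟩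
      · exact ⟨rfl, rfl⟩
      · exact ⟨rfl, huniq a b hb d hd hab hcd⟩
      · exact ⟨huniq b a ha c hc hab.symm hcd.symm, rfl⟩
      · exact (hind a ha b hb hab).elim
    exact h.imp (fun h => key a b c d hab hcd h.1 h.2)
      (fun h => key a b d c hab hcd.symm h.1 h.2)

/-- The graph on `Fin n` whose first `m` vertices form a clique, the others being isolated. -/
def cliqueWithIsolated (n m : ℕ) (h : m ≤ n) : SimpleGraph (Fin n) :=
  (⊤ : SimpleGraph (Fin m)).map (Fin.castLEEmb h)

theorem cliqueWithIsolated_adj {n m : ℕ} {h : m ≤ n} {i j : Fin n} :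
    (cliqueWithIsolated n m h).Adj i j ↔ i ≠ j ∧ (i : ℕ) < m ∧ (j : ℕ) < m := by
  rw [cliqueWithIsolated, SimpleGraph.map_adj]
  constructor
  · rintro ⟨a, b, hab, rfl, rfl⟩
    exact ⟨fun e => hab ((Fin.castLEEmb h).injective e), a.2, b.2⟩
  · rintro ⟨hij, hi, hj⟩
    exact ⟨⟨i, hi⟩, ⟨j, hj⟩, fun e => hij (Fin.ext (Fin.mk.inj e)), rfl, rfl⟩

theorem ncard_edgeSet_cliqueWithIsolated {n m : ℕ} (h : m ≤ n) :
    (cliqueWithIsolated n m h).edgeSet.ncard = m.choose 2 := by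
  classical
  rw [cliqueWithIsolated, SimpleGraph.edgeSet_map,
    Set.ncard_image_of_injective _ (Function.Embedding.injective _),
    ← SimpleGraph.coe_edgeFinset, Set.ncard_coe_finset,
    SimpleGraph.card_edgeFinset_top_eq_card_choose_two, Fintype.card_fin]

/-- The first vertex together with all vertices from `m` on. -/
def firstAndFrom (n m : ℕ) : Set (Fin n) := {i | (i : ℕ) = 0 ∨ m ≤ i}

theorem ncard_firstAndFrom {n m : ℕ} (h : m < n) :
    (firstAndFrom n (m + 1)).ncard = n - m := by
  have : firstAndFrom n (m + 1) =
      ((insert ⟨0, by omega⟩ (Finset.Ioi ⟨m, h⟩) : Finset (Fin n)) : Set (Fin n)) := by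
    ext i
    simp [firstAndFrom, Fin.ext_iff, Fin.lt_def]
  rw [this, Set.ncard_coe_finset, Finset.card_insert_of_notMem (by simp [Fin.lt_def]),
    Fin.card_Ioi]
  dsimp only
  omega

theorem isDomSet_firstAndFrom {n m : ℕ} (h : m ≤ n) :
    IsDomSet (cliqueWithIsolated n m h) (firstAndFrom n m) := by
  intro v
  by_cases hv : (v : ℕ) = 0 ∨ m ≤ v
  · exact ⟨v, hv, Or.inl rfl⟩
  · refine ⟨⟨0, by omega⟩, Or.inl rfl, Or.inr (cliqueWithIsolated_adj.2 ?_)⟩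
    simp only [ne_eq, Fin.ext_iff]
    omega

theorem crOf_firstAndFrom {n m : ℕ} (h : m ≤ n) :
    crOf (cliqueWithIsolated n m h) (firstAndFrom n m) = 0 := by
  rw [crOf_eq_zero_iff]
  intro x a ha b hb hxa hxb
  simp only [mem_closedNbhd, cliqueWithIsolated_adj, firstAndFrom, Set.mem_ofPred_eq, ne_eq,
    Fin.ext_iff] at *
  omega

theorem ncard_firstAndFrom_le {n m : ℕ} (hm : 0 < m) (h : m ≤ n) {T : Set (Fin n)}
    (hT : IsDomSet (cliqueWithIsolated n m h) T) : (firstAndFrom n m).ncard ≤ T.ncard := by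
  let g : Fin n → Fin n := fun i => if (i : ℕ) < m then ⟨0, by omega⟩ else i
  have hsub : firstAndFrom n m ⊆ g '' T := by
    intro i hi
    obtain ⟨s, hs, his⟩ := hT i
    refine ⟨s, hs, ?_⟩
    simp only [mem_closedNbhd, cliqueWithIsolated_adj, firstAndFrom, Set.mem_ofPred_eq, ne_eq,
      Fin.ext_iff] at *
    dsimp only [g]
    split_ifs
    · dsimp only
      omega
    · omega
  exact (Set.ncard_le_ncard hsub).trans (Set.ncard_image_le (Set.toFinite T))

theorem crNum_cliqueWithIsolated {n m : ℕ} (h : m ≤ n) :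
    crNum (cliqueWithIsolated n m h) = 0 :=
  Nat.le_zero.1 (Nat.sInf_le ⟨_, isDomSet_firstAndFrom h, crOf_firstAndFrom h⟩)

theorem gammaCR_cliqueWithIsolated {n m : ℕ} (hm : 0 < m) (h : m ≤ n) :
    gammaCR (cliqueWithIsolated n m h) = (firstAndFrom n m).ncard := by
  apply le_antisymm
  · exact Nat.sInf_le ⟨_, isDomSet_firstAndFrom h,
      (crOf_firstAndFrom h).trans (crNum_cliqueWithIsolated h).symm, rfl⟩
  · obtain ⟨T, hT, -, hcard⟩ := exists_ncard_eq_gammaCR (cliqueWithIsolated n m h)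
    exact hcard ▸ ncard_firstAndFrom_le hm h hT

theorem M_n_zero_r (n r : ℕ) (hn : 2 ≤ n) (hr1 : 1 ≤ r) (hr2 : r ≤ n - 1) :
    (∀ (V : Type) [Fintype V] (G : SimpleGraph V), Fintype.card V = n →
        crNum G = 0 → gammaCR G = r →
        G.edgeSet.ncard ≤ (n - r + 1).choose 2) ∧
    (∃ G : SimpleGraph (Fin n), crNum G = 0 ∧ gammaCR G = r ∧
        G.edgeSet.ncard = (n - r + 1).choose 2) := by
  refine ⟨?_, ?_⟩
  · intro V _ G hV h0 hr
    obtain ⟨S, -, hS, hcard⟩ := exists_ncard_eq_gammaCR G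
    rw [← hV, ← hr, ← hcard]
    exact ncard_edgeSet_le_of_crOf_eq_zero (hS.trans h0)
  · have h : n - r + 1 ≤ n := by omega
    refine ⟨cliqueWithIsolated n (n - r + 1) h, crNum_cliqueWithIsolated h, ?_,
      ncard_edgeSet_cliqueWithIsolated h⟩
    rw [gammaCR_cliqueWithIsolated (Nat.succ_pos _) h, ncard_firstAndFrom (by omega)]
    omega
end

section
/- Let G be a finite simple graph of order n with CR(G) = 1. Then n ≥ 5 and γ_CR(G) ≤ n − 3. -/
open SimpleGraph Set

theorem mem_closedNbhd_iff {V : Type*} (G : SimpleGraph V) (v w : V) :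
    w ∈ closedNbhd G v ↔ w = v ∨ G.Adj v w := by
  simp [closedNbhd]

theorem two_le_ncard_closedNbhd_inter_iff {V : Type*} [Finite V] (G : SimpleGraph V)
    (S : Set V) (v : V) :
    2 ≤ (closedNbhd G v ∩ S).ncard ↔
      ∃ s ∈ S, ∃ t ∈ S, s ≠ t ∧ (s = v ∨ G.Adj v s) ∧ (t = v ∨ G.Adj v t) := by
  rw [← Nat.lt_iff_add_one_le, Set.one_lt_ncard]
  simp only [Set.mem_inter_iff, mem_closedNbhd_iff]
  grind

theorem isDomSet_iff {V : Type*} (G : SimpleGraph V) (S : Set V) :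
    IsDomSet G S ↔ ∀ v, ∃ s ∈ S, s = v ∨ G.Adj v s := by
  simp only [IsDomSet, mem_closedNbhd_iff, G.adj_comm, eq_comm]

/-- If `S` overdominates only `x`, then either some dominating set overdominates no vertex, or
some dominating set overdominates at most one vertex and omits at least three vertices. -/
theorem exists_efficient_or_three_notMem {V : Type*} (G : SimpleGraph V) (S : Set V) (x : V)
    (hdom : ∀ v, ∃ s ∈ S, s = v ∨ G.Adj v s)
    (huniq : ∀ v, v ≠ x → ∀ s ∈ S, ∀ t ∈ S, (s = v ∨ G.Adj v s) → (t = v ∨ G.Adj v t) → s = t)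
    (hx : ∃ s ∈ S, ∃ t ∈ S, s ≠ t ∧ (s = x ∨ G.Adj x s) ∧ (t = x ∨ G.Adj x t)) :
    (∃ T : Set V, (∀ v, ∃ s ∈ T, s = v ∨ G.Adj v s) ∧
      ∀ v, ∀ s ∈ T, ∀ t ∈ T, (s = v ∨ G.Adj v s) → (t = v ∨ G.Adj v t) → s = t) ∨
    ∃ T : Set V, (∀ v, ∃ s ∈ T, s = v ∨ G.Adj v s) ∧
      (∃ z, ∀ v, v ≠ z → ∀ s ∈ T, ∀ t ∈ T,
        (s = v ∨ G.Adj v s) → (t = v ∨ G.Adj v t) → s = t) ∧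
      ∃ a b c, a ∉ T ∧ b ∉ T ∧ c ∉ T ∧ a ≠ b ∧ a ≠ c ∧ b ≠ c := by
  have symm : ∀ u v, G.Adj u v → G.Adj v u := fun _ _ h => h.symm
  have irrefl : ∀ u, ¬ G.Adj u u := fun _ => G.irrefl
  have hxS : x ∉ S := fun h => by
    obtain ⟨s, hs, hsx, hxs⟩ : ∃ s ∈ S, s ≠ x ∧ G.Adj x s := by grind
    exact hsx (huniq s hsx s hs x h (Or.inl rfl) (Or.inr hxs.symm))
  have indep : ∀ s ∈ S, ∀ t ∈ S, ¬ G.Adj s t := fun s hs t ht hst =>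
    hst.ne (huniq s (fun h => hxS (h ▸ hs)) s hs t ht (Or.inl rfl) (Or.inr hst))
  obtain ⟨a, ha, b, hb, hab, hxa, hxb⟩ := hx
  replace hxa : G.Adj x a := by grind
  replace hxb : G.Adj x b := by grind
  by_cases h3 : ∃ u v, u ∉ S ∧ v ∉ S ∧ x ≠ u ∧ x ≠ v ∧ u ≠ v
  · obtain ⟨u, v, hu, hv, h1, h2, h3⟩ := h3
    exact Or.inr ⟨S, hdom, ⟨x, huniq⟩, x, u, v, hxS, hu, hv, h1, h2, h3⟩
  obtain ⟨y, hyS, hy⟩ : ∃ y, y ∉ S ∧ ∀ z, z ∉ S → z = x ∨ z = y := by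
    by_cases h : ∃ y, y ∉ S ∧ y ≠ x
    · obtain ⟨y, hyS, hyx⟩ := h
      exact ⟨y, hyS, by grind⟩
    · exact ⟨x, hxS, by grind⟩
  by_cases hyx : y = x
  · subst hyx
    refine Or.inl ⟨{s | s = y ∨ s ∈ S ∧ ¬ G.Adj y s}, ?_, ?_⟩
    · simp only [Set.mem_ofPred_eq]; grind
    · simp only [Set.mem_ofPred_eq]; grind
  by_cases hadj : G.Adj x y
  · refine Or.inr ⟨{s | s = x ∨ s ∈ S ∧ ¬ G.Adj x s}, ?_, ⟨y, ?_⟩, a, b, y, ?_⟩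
    · simp only [Set.mem_ofPred_eq]; grind
    · simp only [Set.mem_ofPred_eq]; grind
    · simp only [Set.mem_ofPred_eq]; grind
  obtain ⟨t, ht, hty⟩ := hdom y
  replace hty : G.Adj y t := by grind
  by_cases hxt : G.Adj x t
  · by_cases hthird : ∃ c ∈ S, G.Adj x c ∧ c ≠ a ∧ c ≠ b
    · obtain ⟨c, hc, hxc, hca, hcb⟩ := hthird
      refine Or.inr ⟨{s | s = x ∨ s = y ∨ s ∈ S ∧ ¬ G.Adj x s}, ?_, ⟨t, ?_⟩, a, b, c, ?_⟩
      · simp only [Set.mem_ofPred_eq]; grind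
      · simp only [Set.mem_ofPred_eq]; grind
      · simp only [Set.mem_ofPred_eq]; grind
    · refine Or.inl ⟨{s | s = y ∨ s ∈ S ∧ s ≠ t}, ?_, ?_⟩
      · simp only [Set.mem_ofPred_eq]; grind
      · simp only [Set.mem_ofPred_eq]; grind
  · refine Or.inl ⟨{s | s = x ∨ s ∈ S ∧ ¬ G.Adj x s}, ?_, ?_⟩
    · simp only [Set.mem_ofPred_eq]; grind
    · simp only [Set.mem_ofPred_eq]; grind

theorem crNum_eq_one_order_and_gamma {V : Type*} [Fintype V] (G : SimpleGraph V)
    (h : crNum G = 1) :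
    5 ≤ Fintype.card V ∧ gammaCR G ≤ Fintype.card V - 3 := by
  have hle : ∀ T, IsDomSet G T → 1 ≤ crOf G T := fun T hT => by
    rw [← h]; exact Nat.sInf_le ⟨T, hT, rfl⟩
  obtain ⟨S, hS, hcr⟩ : ∃ S, IsDomSet G S ∧ crOf G S = 1 := by
    have hmem := Nat.sInf_mem (Nat.nonempty_of_sInf_eq_succ (k := 0) h)
    exact h ▸ hmem
  obtain ⟨x, hx⟩ := Set.ncard_eq_one.mp hcr
  simp only [Set.ext_iff, Set.mem_ofPred_eq, Set.mem_singleton_iff,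
    two_le_ncard_closedNbhd_inter_iff] at hx
  rcases exists_efficient_or_three_notMem G S x ((isDomSet_iff G S).mp hS)
    (fun v hv s hs t ht h1 h2 => by
      by_contra hne
      exact hv ((hx v).mp ⟨s, hs, t, ht, hne, h1, h2⟩)) ((hx x).mpr rfl) with
    ⟨T, hT, huniq⟩ | ⟨T, hT, ⟨z, huniq⟩, a, b, c, ha, hb, hc, hab, hac, hbc⟩
  · have h1 := hle T ((isDomSet_iff G T).mpr hT)
    obtain ⟨v, hv⟩ := Set.nonempty_of_ncard_ne_zero (Nat.ne_of_gt h1)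
    obtain ⟨s, hs, t, ht, hne, h1, h2⟩ := (two_le_ncard_closedNbhd_inter_iff G T v).mp hv
    exact (hne (huniq v s hs t ht h1 h2)).elim
  · have hTdom := (isDomSet_iff G T).mpr hT
    have h1 := hle T hTdom
    have h2 : crOf G T ≤ 1 := by
      have hsub : {v : V | 2 ≤ (closedNbhd G v ∩ T).ncard} ⊆ {z} := fun v hv => by
        by_contra hvz
        obtain ⟨s, hs, t, ht, hne, h1, h2⟩ := (two_le_ncard_closedNbhd_inter_iff G T v).mp hv
        exact hne (huniq v hvz s hs t ht h1 h2)
      simpa [crOf] using Set.ncard_le_ncard hsub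
    have hγ : gammaCR G ≤ T.ncard := Nat.sInf_le ⟨T, hTdom, by omega, rfl⟩
    obtain ⟨v, hv⟩ := Set.nonempty_of_ncard_ne_zero (Nat.ne_of_gt h1)
    have hT2 : 2 ≤ T.ncard :=
      le_trans (Set.mem_ofPred_eq ▸ hv) (Set.ncard_le_ncard Set.inter_subset_right)
    have hTc : 2 < Tᶜ.ncard :=
      (Set.two_lt_ncard_iff (Set.toFinite _)).mpr ⟨a, b, c, ha, hb, hc, hab, hac, hbc⟩
    have hsum := Set.ncard_add_ncard_compl T
    rw [Nat.card_eq_fintype_card] at hsum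
    omega
end
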